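/- (Local contraction estimate with unbounded rewards) Let Z be a compact metric space, X = A a metric space covered as X = ⋃_j int(K_j) by a strictly increasing sequence {K_j} of compact subsets, and H(x,z,a,v) = u(x,z,a) + β(z) ∫ v(a,z') Q(z,dz') with u continuous, β bounded measurable, Γ continuous, nonempty and compact valued, and Q Feller. Assume Γ(x,z) ⊂ K_j for all x ∈ K_j, all z ∈ Z, and all j. Define ‖f‖_j := sup_{x∈K_j, z∈Z} |f(x,z)| for continuous f on S = X × Z. Then for all continuous v, w on S that are bounded on each K_j × Z (with T^n v, T^n w defined by (Tv)(x,z) = sup_{a∈Γ(x,z)} H(x,z,a,v)), all j, and all n ≥ 1: ‖T^n v − T^n w‖_j ≤ m_n · ‖v − w‖_j, where m_n := sup_{z∈Z} E_z[∏_{t=0}^{n-1} β(Z_t)]. In particular, if r(L_β) < 1 then T is a 0-local contraction. -/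

import Mathlib

open MeasureTheory ProbabilityTheory Filter Topology BoundedContinuousFunction

/-- `expProd Q β n z` is the expectation `E_z[∏_{t=0}^{n-1} β(Z_t)]` of the product of
discount factors along the Markov chain generated by the kernel `Q` and started at `z`,
encoded by the canonical iterated-integral recursion (the empty product is `1`). -/
noncomputable def expProd {Z : Type*} [MeasurableSpace Z] (Q : ProbabilityTheory.Kernel Z Z)
    (β : Z → ℝ) : ℕ → Z → ℝ
  | 0 => fun _ => 1
  | n + 1 => fun z => β z * ∫ z', expProd Q β n z' ∂(Q z)

/-- `mSup Q β n = sup_{z ∈ Z} E_z[∏_{t=0}^{n-1} β(Z_t)]`. -/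
noncomputable def mSup {Z : Type*} [MeasurableSpace Z] (Q : ProbabilityTheory.Kernel Z Z)
    (β : Z → ℝ) (n : ℕ) : ℝ :=
  ⨆ z, expProd Q β n z

/-- Lower hemicontinuity of a correspondence. -/
def LowerHemicontinuousCorr {S A : Type*} [TopologicalSpace S] [TopologicalSpace A]
    (Γ : S → Set A) : Prop :=
  ∀ s : S, ∀ U : Set A, IsOpen U → (Γ s ∩ U).Nonempty →
    ∀ᶠ t in nhds s, (Γ t ∩ U).Nonempty

/-- Upper hemicontinuity of a correspondence. -/
def UpperHemicontinuousCorr {S A : Type*} [TopologicalSpace S] [TopologicalSpace A]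
    (Γ : S → Set A) : Prop :=
  ∀ s : S, ∀ U : Set A, IsOpen U → Γ s ⊆ U → ∀ᶠ t in nhds s, Γ t ⊆ U

/-- The supremum of a Carathéodory function over a weakly measurable compact-valued correspondence
into a compact metric set is measurable. -/
lemma measurable_sSup_image_of_isCompact {S A : Type*} [MeasurableSpace S] [PseudoMetricSpace A]
    {K : Set A} (hK : IsCompact K) {Γ : S → Set A} (hΓK : ∀ s, Γ s ⊆ K)
    (hΓne : ∀ s, (Γ s).Nonempty) (hΓcp : ∀ s, IsCompact (Γ s))
    (hΓm : ∀ U, IsOpen U → MeasurableSet {s | (Γ s ∩ U).Nonempty})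
    {F : S → A → ℝ} (hFm : ∀ a, Measurable fun s => F s a) (hFc : ∀ s, Continuous (F s)) :
    Measurable fun s => sSup (F s '' Γ s) := by
  obtain ⟨D, hDK, hDc, hKD⟩ := hK.isSeparable.exists_countable_dense_subset
  have key : ∀ c s, sSup (F s '' Γ s) ≤ c ↔ ∀ k : ℕ, ∃ n : ℕ, ∀ d ∈ D,
      (Γ s ∩ Metric.ball d (1 / ((n : ℝ) + 1))).Nonempty → F s d ≤ c + 1 / ((k : ℝ) + 1) := by
    intro c s
    rw [csSup_le_iff ((hΓcp s).image (hFc s)).bddAbove ((hΓne s).image _), Set.forall_mem_image]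
    constructor
    · intro h k
      obtain ⟨δ, hδ, hF⟩ := Metric.uniformContinuousOn_iff.1
        (hK.uniformContinuousOn_of_continuous (hFc s).continuousOn) (1 / ((k : ℝ) + 1))
        Nat.one_div_pos_of_nat
      obtain ⟨n, hn⟩ := exists_nat_one_div_lt hδ
      refine ⟨n, fun d hd ⟨a, haΓ, had⟩ => ?_⟩
      have h1 := hF d (hDK hd) a (hΓK s haΓ)
        ((dist_comm d a).trans_lt ((Metric.mem_ball.1 had).trans hn))
      have h2 := h haΓ
      rw [Real.dist_eq] at h1
      linarith [le_abs_self (F s d - F s a)]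
    · intro h a ha
      refine le_of_forall_pos_le_add fun ε hε => ?_
      obtain ⟨k, hk⟩ := exists_nat_one_div_lt (half_pos hε)
      obtain ⟨n, hn⟩ := h k
      obtain ⟨δ, hδ, hF⟩ := Metric.continuous_iff.1 (hFc s) a (ε / 2) (half_pos hε)
      obtain ⟨d, hd, had⟩ := Metric.mem_closure_iff.1 (hKD (hΓK s ha))
        (min δ (1 / ((n : ℝ) + 1))) (lt_min hδ Nat.one_div_pos_of_nat)
      have h1 := hn d hd ⟨a, ha, had.trans_le (min_le_right _ _)⟩
      have h2 := hF d ((dist_comm d a).trans_lt (had.trans_le (min_le_left _ _)))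
      rw [Real.dist_eq] at h2
      linarith [neg_abs_le (F s d - F s a)]
  refine measurable_of_Iic fun c => ?_
  have hset : (fun s => sSup (F s '' Γ s)) ⁻¹' Set.Iic c =
      ⋂ k : ℕ, ⋃ n : ℕ, ⋂ d ∈ D, ({s | (Γ s ∩ Metric.ball d (1 / ((n : ℝ) + 1))).Nonempty}ᶜ ∪
        {s | F s d ≤ c + 1 / ((k : ℝ) + 1)}) := by
    ext s
    simp only [Set.mem_preimage, Set.mem_Iic, key, Set.mem_iInter, Set.mem_iUnion, Set.mem_union,
      Set.mem_compl_iff, Set.mem_ofPred_eq, imp_iff_not_or]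
  rw [hset]
  exact MeasurableSet.iInter fun k => MeasurableSet.iUnion fun n => MeasurableSet.biInter hDc
    fun d _ => (hΓm _ Metric.isOpen_ball).compl.union (measurableSet_le (hFm d) measurable_const)

/-- Berge's maximum theorem. -/
lemma continuous_sSup_image_of_hemicontinuous {S A : Type*} [TopologicalSpace S]
    [TopologicalSpace A] {Γ : S → Set A} (hΓl : LowerHemicontinuousCorr Γ)
    (hΓu : UpperHemicontinuousCorr Γ) (hΓne : ∀ s, (Γ s).Nonempty) (hΓcp : ∀ s, IsCompact (Γ s))
    {F : S → A → ℝ} (hF : Continuous fun p : S × A => F p.1 p.2) :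
    Continuous fun s => sSup (F s '' Γ s) := by
  have hFs : ∀ s, ContinuousOn (F s) (Γ s) := fun s =>
    (hF.comp (Continuous.prodMk_right s)).continuousOn
  refine continuous_iff_continuousAt.2 fun s => tendsto_order.2 ⟨fun c hc => ?_, fun c hc => ?_⟩
  · obtain ⟨_, ⟨a, ha, rfl⟩, hca⟩ := exists_lt_of_lt_csSup ((hΓne s).image _) hc
    obtain ⟨V, W, hV, hW, hsV, haW, hVW⟩ := isOpen_prod_iff.1 (isOpen_Ioi.preimage hF) s a hca
    filter_upwards [hV.mem_nhds hsV, hΓl s W hW ⟨a, ha, haW⟩] with t ht ⟨b, hb, hbW⟩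
    exact lt_csSup_of_lt ((hΓcp t).image_of_continuousOn (hFs t)).bddAbove
      (Set.mem_image_of_mem _ hb) (hVW (Set.mk_mem_prod ht hbW))
  · replace hc := ((hΓcp s).sSup_lt_iff_of_continuous (hΓne s) (hFs s) c).1 hc
    obtain ⟨V, W, hV, hW, hsV, hΓW, hVW⟩ := generalized_tube_lemma (isCompact_singleton (x := s))
      (hΓcp s) (isOpen_Iio.preimage hF) (by rintro ⟨t, a⟩ ⟨rfl, ha⟩; exact hc a ha)
    filter_upwards [hV.mem_nhds (Set.singleton_subset_iff.1 hsV), hΓu s W hW hΓW] with t ht htW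
    rw [(hΓcp t).sSup_lt_iff_of_continuous (hΓne t) (hFs t)]
    exact fun a ha => hVW (Set.mk_mem_prod ht (htW ha))

lemma abs_sSup_image_sub_sSup_image_le {A : Type*} {Γ : Set A} (hΓ : Γ.Nonempty) {F G : A → ℝ}
    (hF : BddAbove (F '' Γ)) (hG : BddAbove (G '' Γ)) {B : ℝ} (h : ∀ a ∈ Γ, |F a - G a| ≤ B) :
    |sSup (F '' Γ) - sSup (G '' Γ)| ≤ B := by
  rw [abs_sub_le_iff, sub_le_iff_le_add, sub_le_iff_le_add]
  constructor <;> refine csSup_le (hΓ.image _) (Set.forall_mem_image.2 fun a ha => ?_)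
  · linarith [le_csSup hG (Set.mem_image_of_mem G ha), (abs_le.1 (h a ha)).2]
  · linarith [le_csSup hF (Set.mem_image_of_mem F ha), (abs_le.1 (h a ha)).1]

section expProd

variable {Z : Type*} [MeasurableSpace Z] {Q : ProbabilityTheory.Kernel Z Z} {β : Z → ℝ}

lemma measurable_expProd (hβ : Measurable β) (n : ℕ) : Measurable (expProd Q β n) := by
  induction n with
  | zero => exact measurable_const
  | succ n ih => exact hβ.mul ih.stronglyMeasurable.integral_kernel.measurable

lemma expProd_nonneg (hβ : ∀ z, 0 ≤ β z) (n : ℕ) (z : Z) : 0 ≤ expProd Q β n z := by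
  induction n generalizing z with
  | zero => exact zero_le_one
  | succ n ih => exact mul_nonneg (hβ z) (integral_nonneg ih)

lemma expProd_le_pow [IsMarkovKernel Q] (hβ : ∀ z, 0 ≤ β z) {C : ℝ} (hC : ∀ z, β z ≤ C)
    (n : ℕ) (z : Z) : expProd Q β n z ≤ C ^ n := by
  induction n generalizing z with
  | zero => exact le_rfl
  | succ n ih =>
    have hint : ∫ z', expProd Q β n z' ∂(Q z) ≤ C ^ n := by
      refine (le_abs_self _).trans ?_
      simpa using norm_integral_le_of_norm_le_const (μ := Q z) (f := expProd Q β n) (C := C ^ n)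
        (.of_forall fun z' => by
          rw [Real.norm_of_nonneg (expProd_nonneg hβ n z')]; exact ih z')
    rw [pow_succ']
    exact mul_le_mul (hC z) hint (integral_nonneg (expProd_nonneg hβ n)) ((hβ z).trans (hC z))

lemma integrable_expProd [IsMarkovKernel Q] (hβm : Measurable β) (hβ : ∀ z, 0 ≤ β z)
    {C : ℝ} (hC : ∀ z, β z ≤ C) (n : ℕ) (z : Z) : Integrable (expProd Q β n) (Q z) :=
  .of_bound (measurable_expProd hβm n).aestronglyMeasurable (C ^ n) (.of_forall fun z' => by
    rw [Real.norm_of_nonneg (expProd_nonneg hβ n z')]; exact expProd_le_pow hβ hC n z')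

lemma expProd_le_mSup [IsMarkovKernel Q] (hβ : ∀ z, 0 ≤ β z) {C : ℝ} (hC : ∀ z, β z ≤ C)
    (n : ℕ) (z : Z) : expProd Q β n z ≤ mSup Q β n :=
  le_ciSup ⟨C ^ n, Set.forall_mem_range.2 (expProd_le_pow hβ hC n)⟩ z

lemma mSup_nonneg (hβ : ∀ z, 0 ≤ β z) (n : ℕ) : 0 ≤ mSup Q β n :=
  Real.iSup_nonneg (expProd_nonneg hβ n)

end expProd

/-- Functions continuous in the first variable, measurable in the second one, and bounded on each
`K j × Z`. -/
structure IsLocallyBoundedCaratheodory {X Z : Type*} [TopologicalSpace X] [MeasurableSpace Z]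
    (K : ℕ → Set X) (f : X × Z → ℝ) : Prop where
  continuous_left : ∀ z, Continuous fun x => f (x, z)
  measurable_right : ∀ x, Measurable fun z => f (x, z)
  bounded : ∀ j, ∃ M, ∀ x ∈ K j, ∀ z, |f (x, z)| ≤ M

/-- The Bellman operator of the aggregator `u x z a + β z * ∫ v (a, z') ∂(Q z)` and the
feasibility correspondence `Γ`. -/
noncomputable def bellman {X Z : Type*} [MeasurableSpace Z] (Q : ProbabilityTheory.Kernel Z Z)
    (β : Z → ℝ) (u : X → Z → X → ℝ) (Γ : X → Z → Set X) (v : X × Z → ℝ) (p : X × Z) : ℝ :=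
  sSup ((fun a => u p.1 p.2 a + β p.2 * ∫ z', v (a, z') ∂(Q p.2)) '' Γ p.1 p.2)

namespace IsLocallyBoundedCaratheodory

variable {X Z : Type*} [MeasurableSpace Z] {K : ℕ → Set X} {f g : X × Z → ℝ}
  {Q : ProbabilityTheory.Kernel Z Z} [IsMarkovKernel Q]

lemma integrable [TopologicalSpace X] (hf : IsLocallyBoundedCaratheodory K f)
    (hK : (⋃ j, interior (K j)) = Set.univ) (x : X) (z : Z) :
    Integrable (fun z' => f (x, z')) (Q z) := by
  obtain ⟨j, hj⟩ := Set.mem_iUnion.1 (hK ▸ Set.mem_univ x)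
  obtain ⟨M, hM⟩ := hf.bounded j
  exact .of_bound (hf.measurable_right x).aestronglyMeasurable M
    (.of_forall fun z' => hM x (interior_subset hj) z')

lemma continuous_integral [TopologicalSpace X] [FirstCountableTopology X]
    (hf : IsLocallyBoundedCaratheodory K f) (hK : (⋃ j, interior (K j)) = Set.univ) (z : Z) :
    Continuous fun x => ∫ z', f (x, z') ∂(Q z) := by
  refine continuous_iff_continuousAt.2 fun x => ?_
  obtain ⟨j, hj⟩ := Set.mem_iUnion.1 (hK ▸ Set.mem_univ x)
  obtain ⟨M, hM⟩ := hf.bounded j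
  refine MeasureTheory.continuousAt_of_dominated (bound := fun _ => M)
    (.of_forall fun y => (hf.measurable_right y).aestronglyMeasurable) ?_ (integrable_const M)
    (.of_forall fun z' => (hf.continuous_left z').continuousAt)
  filter_upwards [isOpen_interior.mem_nhds hj] with y hy
  exact .of_forall fun z' => hM y (interior_subset hy) z'

lemma continuous_aggregator [TopologicalSpace X] [FirstCountableTopology X] [TopologicalSpace Z]
    (hf : IsLocallyBoundedCaratheodory K f) (hK : (⋃ j, interior (K j)) = Set.univ)
    (β : Z → ℝ) {u : X → Z → X → ℝ} (hu : Continuous fun q : X × Z × X => u q.1 q.2.1 q.2.2)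
    (z : Z) : Continuous fun p : X × X => u p.1 z p.2 + β z * ∫ z', f (p.2, z') ∂(Q z) :=
  (hu.comp (by fun_prop : Continuous fun p : X × X => (p.1, z, p.2))).add
    (continuous_const.mul ((hf.continuous_integral hK z).comp continuous_snd))

variable [MetricSpace X] [TopologicalSpace Z] [CompactSpace Z] [OpensMeasurableSpace Z]
  {β : Z → ℝ} {u : X → Z → X → ℝ} {Γ : X → Z → Set X}

/-- The Bellman operator preserves locally bounded Carathéodory functions. -/
lemma bellman (hf : IsLocallyBoundedCaratheodory K f) (hβm : Measurable β)
    (hβ0 : ∀ z, 0 ≤ β z) {C : ℝ} (hC : ∀ z, β z ≤ C) (hKcp : ∀ j, IsCompact (K j))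
    (hK : (⋃ j, interior (K j)) = Set.univ)
    (hu : Continuous fun q : X × Z × X => u q.1 q.2.1 q.2.2)
    (hΓne : ∀ x z, (Γ x z).Nonempty) (hΓcp : ∀ x z, IsCompact (Γ x z))
    (hΓl : LowerHemicontinuousCorr (fun p : X × Z => Γ p.1 p.2))
    (hΓu : UpperHemicontinuousCorr (fun p : X × Z => Γ p.1 p.2))
    (hΓK : ∀ j : ℕ, ∀ x ∈ K j, ∀ z : Z, Γ x z ⊆ K j) :
    IsLocallyBoundedCaratheodory K (bellman Q β u Γ f) where
  continuous_left z := by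
    refine continuous_sSup_image_of_hemicontinuous (Γ := fun x => Γ x z) ?_ ?_
      (fun x => hΓne x z) (fun x => hΓcp x z) (hf.continuous_aggregator hK β hu z)
    · exact fun x U hU h => (Continuous.prodMk_left z).continuousAt.eventually (hΓl (x, z) U hU h)
    · exact fun x U hU h => (Continuous.prodMk_left z).continuousAt.eventually (hΓu (x, z) U hU h)
  measurable_right x := by
    obtain ⟨j, hj⟩ := Set.mem_iUnion.1 (hK ▸ Set.mem_univ x)
    refine measurable_sSup_image_of_isCompact (hKcp j) (Γ := Γ x)
      (hΓK j x (interior_subset hj)) (hΓne x) (hΓcp x) (fun U hU => ?_) (fun a => ?_)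
      (fun z => (hf.continuous_aggregator hK β hu z).comp (Continuous.prodMk_right x))
    · refine IsOpen.measurableSet (isOpen_iff_eventually.2 fun z hz => ?_)
      exact (Continuous.prodMk_right x).continuousAt.eventually (hΓl (x, z) U hU hz)
    · exact (hu.comp (by fun_prop : Continuous fun z : Z => (x, z, a))).measurable.add
        (hβm.mul (hf.measurable_right a).stronglyMeasurable.integral_kernel.measurable)
  bounded j := by
    obtain ⟨M, hM⟩ := hf.bounded j
    obtain ⟨N, hN⟩ := ((hKcp j).prod (isCompact_univ.prod (hKcp j))).exists_bound_of_continuousOn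
      (f := fun q : X × Z × X => u q.1 q.2.1 q.2.2) hu.continuousOn
    refine ⟨N + C * M, fun x hx z => ?_⟩
    have h := fun a (ha : a ∈ Γ x z) => show
        |(u x z a + β z * ∫ z', f (a, z') ∂(Q z)) - 0| ≤ N + C * M by
      have hint : |∫ z', f (a, z') ∂(Q z)| ≤ M := by
        simpa using norm_integral_le_of_norm_le_const (μ := Q z) (f := fun z' => f (a, z'))
          (.of_forall fun z' => hM a (hΓK j x hx z ha) z')
      rw [sub_zero]
      refine (abs_add_le _ _).trans (add_le_add (hN (x, z, a)
        ⟨hx, Set.mem_univ z, hΓK j x hx z ha⟩) ?_)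
      rw [abs_mul, abs_of_nonneg (hβ0 z)]
      exact mul_le_mul (hC z) hint (abs_nonneg _) ((hβ0 z).trans (hC z))
    have hbdd := ((hΓcp x z).image
      ((hf.continuous_aggregator hK (Q := Q) β hu z).comp (Continuous.prodMk_right x))).bddAbove
    have hconst : (fun _ : X => (0 : ℝ)) '' Γ x z = {0} := (hΓne x z).image_const 0
    have := abs_sSup_image_sub_sSup_image_le (hΓne x z) hbdd (by simp [hconst]) h
    rwa [hconst, csSup_singleton, sub_zero] at this

/-- Pointwise iterate estimate for the Bellman operator. -/
lemma abs_bellman_iterate_sub_le (hf : IsLocallyBoundedCaratheodory K f)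
    (hg : IsLocallyBoundedCaratheodory K g) (hβm : Measurable β)
    (hβ0 : ∀ z, 0 ≤ β z) {C : ℝ} (hC : ∀ z, β z ≤ C) (hKcp : ∀ j, IsCompact (K j))
    (hK : (⋃ j, interior (K j)) = Set.univ)
    (hu : Continuous fun q : X × Z × X => u q.1 q.2.1 q.2.2)
    (hΓne : ∀ x z, (Γ x z).Nonempty) (hΓcp : ∀ x z, IsCompact (Γ x z))
    (hΓl : LowerHemicontinuousCorr (fun p : X × Z => Γ p.1 p.2))
    (hΓu : UpperHemicontinuousCorr (fun p : X × Z => Γ p.1 p.2))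
    (hΓK : ∀ j : ℕ, ∀ x ∈ K j, ∀ z : Z, Γ x z ⊆ K j) {j : ℕ} {N : ℝ}
    (hN : ∀ x ∈ K j, ∀ z, |f (x, z) - g (x, z)| ≤ N) (n : ℕ) :
    ∀ x ∈ K j, ∀ z, |(_root_.bellman Q β u Γ)^[n] f (x, z) - (_root_.bellman Q β u Γ)^[n] g (x, z)|
      ≤ expProd Q β n z * N := by
  have hiter : ∀ {h : X × Z → ℝ}, IsLocallyBoundedCaratheodory K h → ∀ n,
      IsLocallyBoundedCaratheodory K ((_root_.bellman Q β u Γ)^[n] h) := fun hh n => by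
    induction n with
    | zero => exact hh
    | succ n ih =>
      rw [Function.iterate_succ_apply']
      exact ih.bellman hβm hβ0 hC hKcp hK hu hΓne hΓcp hΓl hΓu hΓK
  induction n with
  | zero => simpa [expProd] using hN
  | succ n ih =>
    intro x hx z
    have hf' := hiter hf n
    have hg' := hiter hg n
    rw [Function.iterate_succ_apply', Function.iterate_succ_apply']
    set F := (_root_.bellman Q β u Γ)^[n] f
    set G := (_root_.bellman Q β u Γ)^[n] g
    have hbdd := fun {h : X × Z → ℝ} (hh : IsLocallyBoundedCaratheodory K h) => ((hΓcp x z).image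
      ((hh.continuous_aggregator hK (Q := Q) β hu z).comp (Continuous.prodMk_right x))).bddAbove
    refine abs_sSup_image_sub_sSup_image_le (hΓne x z) (hbdd hf') (hbdd hg') fun a ha => ?_
    have hint : |∫ z', (F (a, z') - G (a, z')) ∂(Q z)| ≤ ∫ z', expProd Q β n z' * N ∂(Q z) :=
      norm_integral_le_of_norm_le (f := fun z' => F (a, z') - G (a, z'))
        ((integrable_expProd hβm hβ0 hC n z).mul_const N) (.of_forall fun z' => ih a (hΓK j x hx z ha) z')
    rw [integral_sub (hf'.integrable hK a z) (hg'.integrable hK a z),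
      integral_mul_const] at hint
    simp only [Function.comp_apply]
    rw [add_sub_add_left_eq_sub, ← mul_sub, abs_mul, abs_of_nonneg (hβ0 z), expProd, mul_assoc]
    exact mul_le_mul_of_nonneg_left hint (hβ0 z)

end IsLocallyBoundedCaratheodory

/-- **Local contraction estimate with unbounded rewards.**
Let `Z` be a compact metric space, `X = A` a metric space covered as `X = ⋃_j int(K_j)`
by a strictly increasing sequence of compact sets, and
`H(x,z,a,v) = u(x,z,a) + β(z) ∫ v(a,z') Q(z,dz')` with `u` continuous, `β` bounded
measurable, `Γ` continuous, nonempty and compact valued with `Γ(x,z) ⊆ K_j` whenever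
`x ∈ K_j`, and `Q` Feller.  Then, with `‖f‖_j := sup_{K_j × Z} |f|`, for all continuous
`v, w` bounded on each `K_j × Z`, all `j` and all `n ≥ 1`,
`‖T^n v − T^n w‖_j ≤ m_n ‖v − w‖_j`.  In particular, if `r(L_β) < 1` then `T` is a
0-local contraction. -/
theorem local_contraction_estimate
    {X Z : Type*} [MetricSpace X]
    [MetricSpace Z] [CompactSpace Z] [Nonempty Z] [MeasurableSpace Z] [BorelSpace Z]
    (Q : ProbabilityTheory.Kernel Z Z) [IsMarkovKernel Q]
    (hFeller : ∀ v : Z →ᵇ ℝ, Continuous fun z => ∫ z', v z' ∂(Q z))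
    (β : Z → ℝ) (hβm : Measurable β) (hβ0 : ∀ z, 0 ≤ β z) (hβb : ∃ C, ∀ z, β z ≤ C)
    (K : ℕ → Set X) (hKcp : ∀ j, IsCompact (K j)) (hKmono : ∀ j, K j ⊂ K (j + 1))
    (hKcover : (⋃ j, interior (K j)) = Set.univ)
    (u : X → Z → X → ℝ)
    (hu : Continuous fun q : X × Z × X => u q.1 q.2.1 q.2.2)
    (Γ : X → Z → Set X)
    (hΓne : ∀ x z, (Γ x z).Nonempty) (hΓcp : ∀ x z, IsCompact (Γ x z))
    (hΓl : LowerHemicontinuousCorr (fun p : X × Z => Γ p.1 p.2))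
    (hΓu : UpperHemicontinuousCorr (fun p : X × Z => Γ p.1 p.2))
    (hΓK : ∀ j : ℕ, ∀ x ∈ K j, ∀ z : Z, Γ x z ⊆ K j) :
    -- the Bellman operator.
    let T : ((X × Z) → ℝ) → ((X × Z) → ℝ) := fun v p =>
      sSup ((fun a => u p.1 p.2 a + β p.2 * ∫ z', v (a, z') ∂(Q p.2)) '' Γ p.1 p.2)
    -- the seminorms `‖f‖_j = sup_{x ∈ K_j, z ∈ Z} |f(x,z)|`.
    let normJ : ((X × Z) → ℝ) → ℕ → ℝ := fun f j =>
      sSup ((fun p : X × Z => |f p|) '' (K j ×ˢ (Set.univ : Set Z)))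
    (∀ v w : (X × Z) → ℝ, Continuous v → Continuous w →
      (∀ j : ℕ, ∃ M, ∀ x ∈ K j, ∀ z : Z, |v (x, z)| ≤ M) →
      (∀ j : ℕ, ∃ M, ∀ x ∈ K j, ∀ z : Z, |w (x, z)| ≤ M) →
      ∀ j : ℕ, ∀ n : ℕ, 1 ≤ n →
        normJ (fun p => T^[n] v p - T^[n] w p) j ≤ mSup Q β n * normJ (fun p => v p - w p) j) ∧
    (∀ r : ℝ, Tendsto (fun n : ℕ => mSup Q β n ^ ((n : ℝ)⁻¹)) atTop (𝓝 r) → r < 1 →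
      ∃ (n : ℕ) (lam : ℝ), 0 ≤ lam ∧ lam < 1 ∧
        ∀ v w : (X × Z) → ℝ, Continuous v → Continuous w →
          (∀ j : ℕ, ∃ M, ∀ x ∈ K j, ∀ z : Z, |v (x, z)| ≤ M) →
          (∀ j : ℕ, ∃ M, ∀ x ∈ K j, ∀ z : Z, |w (x, z)| ≤ M) →
          ∀ j : ℕ,
            normJ (fun p => T^[n] v p - T^[n] w p) j ≤
              lam * normJ (fun p => v p - w p) j) := by
  obtain ⟨C, hC⟩ := hβb
  intro T normJ
  have hcar : ∀ v : X × Z → ℝ, Continuous v →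
      (∀ j : ℕ, ∃ M, ∀ x ∈ K j, ∀ z : Z, |v (x, z)| ≤ M) → IsLocallyBoundedCaratheodory K v :=
    fun v hv hb => ⟨fun z => hv.comp (Continuous.prodMk_left z),
      fun x => (hv.comp (Continuous.prodMk_right x)).measurable, hb⟩
  have main : ∀ v w : (X × Z) → ℝ, Continuous v → Continuous w →
      (∀ j : ℕ, ∃ M, ∀ x ∈ K j, ∀ z : Z, |v (x, z)| ≤ M) →
      (∀ j : ℕ, ∃ M, ∀ x ∈ K j, ∀ z : Z, |w (x, z)| ≤ M) →
      ∀ j n : ℕ, normJ (fun p => T^[n] v p - T^[n] w p) j ≤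
        mSup Q β n * normJ (fun p => v p - w p) j := by
    intro v w hv hw hvb hwb j n
    have hnorm : 0 ≤ normJ (fun p => v p - w p) j :=
      Real.sSup_nonneg (Set.forall_mem_image.2 fun _ _ => abs_nonneg _)
    have hN : ∀ x ∈ K j, ∀ z, |v (x, z) - w (x, z)| ≤ normJ (fun p => v p - w p) j :=
      fun x hx z => le_csSup (((hKcp j).prod isCompact_univ).image (hv.sub hw).abs).bddAbove
        ⟨(x, z), ⟨hx, Set.mem_univ z⟩, rfl⟩
    refine Real.sSup_le (Set.forall_mem_image.2 ?_) (mul_nonneg (mSup_nonneg hβ0 n) hnorm)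
    rintro ⟨x, z⟩ ⟨hx, -⟩
    exact ((hcar v hv hvb).abs_bellman_iterate_sub_le (hcar w hw hwb) hβm hβ0 hC hKcp hKcover hu
      hΓne hΓcp hΓl hΓu hΓK hN n x hx z).trans
      (mul_le_mul_of_nonneg_right (expProd_le_mSup hβ0 hC n z) hnorm)
  refine ⟨fun v w hv hw hvb hwb j n _ => main v w hv hw hvb hwb j n, fun r hr hr1 => ?_⟩
  obtain ⟨n, hn⟩ := (hr.eventually_lt_const hr1).exists
  refine ⟨n, mSup Q β n, mSup_nonneg hβ0 n, ?_,
    fun v w hv hw hvb hwb j => main v w hv hw hvb hwb j n⟩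
  by_contra! h
  exact hn.not_ge (Real.one_le_rpow h (by positivity))
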